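/- Let (a,b,c,d) ∈ P_gen, let γ₁, γ₂ ∈ S_reg, and let z ∈ {z₋, z₊}. Then D(Φ_{γ₁}, Φ_{γ₂})(zq^{−k}) = (γ₁ − γ₂)·K_z·(γ₁γ₂)^{k−1}·(1 + O(q^k)) as k → ∞; precisely, there exist M > 0 and N ∈ ℕ, with |zq^{−N}| > 1/|b|, such that for all k ≥ N (so the series defining Φ_{γ₁} and Φ_{γ₂} converge at zq^{−k} and zq^{1−k}): |D(Φ_{γ₁}, Φ_{γ₂})(zq^{−k}) − (γ₁ − γ₂)·K_z·(γ₁γ₂)^{k−1}| ≤ M·q^k·|γ₁γ₂|^k. -/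

import Mathlib

open Complex Filter

noncomputable section

namespace VVBQJ

/-- The infinite q-shifted factorial `(x;q)_∞`. -/
def poch (q x : ℂ) : ℂ := ∏' j : ℕ, (1 - x * q ^ j)

/-- The q-shifted factorial `(x;q)_n`, `n ∈ ℕ`. -/
def pochN (q x : ℂ) (n : ℕ) : ℂ := ∏ j ∈ Finset.range n, (1 - x * q ^ j)

/-- The normalized Jacobi theta function `θ(x) = (x;q)_∞ (q/x;q)_∞`. -/
def theta (q x : ℂ) : ℂ := poch q x * poch q (q / x)

/-- The condition on the pairs `(a,b)` and `(c,d)` in the parameter set `P`. -/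
def pairCond (q zm zp : ℝ) (α β : ℂ) : Prop :=
  α = (starRingEnd ℂ) β ∨
    (∃ (A B : ℝ) (k₀ : ℤ), α = (A : ℂ) ∧ β = (B : ℂ) ∧
      zp * q ^ k₀ < 1 / B ∧ 1 / B < 1 / A ∧ 1 / A < zp * q ^ (k₀ - 1)) ∨
    (∃ (A B : ℝ) (k₀ : ℤ), α = (A : ℂ) ∧ β = (B : ℂ) ∧
      zm * q ^ (k₀ - 1) < 1 / A ∧ 1 / A < 1 / B ∧ 1 / B < zm * q ^ k₀)

/-- The parameter domain `P`. -/
def memP (q zm zp : ℝ) (a b c d : ℂ) : Prop :=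
  a ≠ 0 ∧ b ≠ 0 ∧ c ≠ 0 ∧ d ≠ 0 ∧ a ≠ b ∧
    (∀ x ∈ ({a, b, c, d} : Set ℂ), ∀ k : ℤ,
      x ≠ ((zp : ℂ))⁻¹ * (q : ℂ) ^ k ∧ x ≠ ((zm : ℂ))⁻¹ * (q : ℂ) ^ k) ∧
    pairCond q zm zp a b ∧ pairCond q zm zp c d

/-- The generic parameter domain `P_gen`. -/
def memPgen (q zm zp : ℝ) (a b c d : ℂ) : Prop :=
  memP q zm zp a b c d ∧ c ≠ d ∧
    ∀ k : ℤ, c / a ≠ (q : ℂ) ^ k ∧ c / b ≠ (q : ℂ) ^ k ∧ d / a ≠ (q : ℂ) ^ k ∧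
      d / b ≠ (q : ℂ) ^ k ∧ c * d / (a * b) ≠ (q : ℂ) ^ k

/-- `s = √(cdq/(ab))`, with the principal branch of the square root. -/
def sP (q : ℝ) (a b c d : ℂ) : ℂ := (c * d * (q : ℂ) / (a * b)) ^ ((1 : ℂ) / 2)

def Acoef (q : ℝ) (a b c d : ℂ) (x : ℝ) : ℂ :=
  (sP q a b c d)⁻¹ * (1 - (q : ℂ) / (a * (x : ℂ))) * (1 - (q : ℂ) / (b * (x : ℂ)))

def Bcoef (q : ℝ) (a b c d : ℂ) (x : ℝ) : ℂ :=
  sP q a b c d * (1 - 1 / (c * (x : ℂ))) * (1 - 1 / (d * (x : ℂ)))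

def Ccoef (q : ℝ) (a b c d : ℂ) (x : ℝ) : ℂ :=
  sP q a b c d + (sP q a b c d)⁻¹ - Acoef q a b c d x - Bcoef q a b c d x

/-- The second order q-difference operator `L`. -/
def Lop (q : ℝ) (a b c d : ℂ) (f : ℝ → ℂ) (x : ℝ) : ℂ :=
  Acoef q a b c d x * f (x / q) + Bcoef q a b c d x * f (q * x) + Ccoef q a b c d x * f x

/-- The weight function `w`. -/
def w (q : ℝ) (a b c d : ℂ) (x : ℝ) : ℂ :=
  poch q (a * (x : ℂ)) * poch q (b * (x : ℂ)) / (poch q (c * (x : ℂ)) * poch q (d * (x : ℂ)))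

/-- The function `u(x) = (1-q)² B(x) x² w(x)`. -/
def u (q : ℝ) (a b c d : ℂ) (x : ℝ) : ℂ :=
  (1 - (q : ℂ)) ^ 2 * Bcoef q a b c d x * (x : ℂ) ^ 2 * w q a b c d x

/-- The Casorati determinant `D(f,g)`. -/
def casD (q : ℝ) (a b c d : ℂ) (f g : ℝ → ℂ) (x : ℝ) : ℂ :=
  (f x * g (q * x) - f (q * x) * g x) * u q a b c d x / ((1 - (q : ℂ)) * (x : ℂ))

/-- The truncated inner product `⟨f,g⟩_{k,l;m,n}`. -/
def trunc (q zm zp : ℝ) (a b c d : ℂ) (f g : ℝ → ℂ) (k l m n : ℤ) : ℂ :=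
  (1 - (q : ℂ)) *
    ((∑ j ∈ Finset.Icc n m, f (zp * q ^ j) * (starRingEnd ℂ) (g (zp * q ^ j)) *
        w q a b c d (zp * q ^ j) * ((zp * q ^ j : ℝ) : ℂ)) -
      ∑ j ∈ Finset.Icc k l, f (zm * q ^ j) * (starRingEnd ℂ) (g (zm * q ^ j)) *
        w q a b c d (zm * q ^ j) * ((zm * q ^ j : ℝ) : ℂ))

/-- The constant `K_z`. -/
def Kz (q : ℝ) (a b c d : ℂ) (z : ℝ) : ℂ :=
  (z : ℂ) * (1 - (q : ℂ)) * (theta q (a * z) * theta q (b * z)) /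
    (theta q (c * z) * theta q (d * z))

/-- Membership in the Hilbert space `ℒ²(ℝ_q, w(x) d_q x)`. -/
def memL2 (q zm zp : ℝ) (a b c d : ℂ) (f : ℝ → ℂ) : Prop :=
  Summable (fun k : ℤ => ‖f (zp * q ^ k)‖ ^ 2 * ‖w q a b c d (zp * q ^ k)‖ * |zp * q ^ k|) ∧
    Summable (fun k : ℤ => ‖f (zm * q ^ k)‖ ^ 2 * ‖w q a b c d (zm * q ^ k)‖ * |zm * q ^ k|)

/-- The inner product on `ℒ²`. -/
def innerL2 (q zm zp : ℝ) (a b c d : ℂ) (f g : ℝ → ℂ) : ℂ :=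
  (1 - (q : ℂ)) *
    ((∑' k : ℤ, f (zp * q ^ k) * (starRingEnd ℂ) (g (zp * q ^ k)) *
        w q a b c d (zp * q ^ k) * ((zp * q ^ k : ℝ) : ℂ)) -
      ∑' k : ℤ, f (zm * q ^ k) * (starRingEnd ℂ) (g (zm * q ^ k)) *
        w q a b c d (zm * q ^ k) * ((zm * q ^ k : ℝ) : ℂ))

/-- The squared `ℒ²`-norm. -/
def normSqL2 (q zm zp : ℝ) (a b c d : ℂ) (f : ℝ → ℂ) : ℝ :=
  (1 - q) *
    ((∑' k : ℤ, ‖f (zp * q ^ k)‖ ^ 2 * ‖w q a b c d (zp * q ^ k)‖ * (zp * q ^ k)) +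
      ∑' k : ℤ, ‖f (zm * q ^ k)‖ ^ 2 * ‖w q a b c d (zm * q ^ k)‖ * (-(zm * q ^ k)))

/-- The q-difference operator `D_q`. -/
def Dq (q : ℝ) (f : ℝ → ℂ) (x : ℝ) : ℂ := (f x - f (q * x)) / ((1 - (q : ℂ)) * (x : ℂ))

/-- The q-line `ℝ_q`. -/
def Rq (q zm zp : ℝ) : Set ℝ := {x | ∃ k : ℤ, x = zm * q ^ k ∨ x = zp * q ^ k}

/-- Membership in the domain `𝒟`. -/
def memD (q zm zp : ℝ) (a b c d : ℂ) (f : ℝ → ℂ) : Prop :=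
  memL2 q zm zp a b c d f ∧ memL2 q zm zp a b c d (Lop q a b c d f) ∧
    (∃ v : ℂ, Tendsto (fun k : ℕ => f (zm * q ^ k)) atTop (nhds v) ∧
        Tendsto (fun k : ℕ => f (zp * q ^ k)) atTop (nhds v)) ∧
    (∃ v : ℂ, Tendsto (fun k : ℕ => Dq q f (zm * q ^ k)) atTop (nhds v) ∧
        Tendsto (fun k : ℕ => Dq q f (zp * q ^ k)) atTop (nhds v))

/-- Membership in the eigenspace `V_μ` (functions on `ℝ_q`). -/
def memV (q zm zp : ℝ) (a b c d : ℂ) (μ : ℂ) (f : ℝ → ℂ) : Prop :=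
  (∀ x ∈ Rq q zm zp, Lop q a b c d f x = μ * f x) ∧
    (∃ v : ℂ, Tendsto (fun k : ℕ => f (zm * q ^ k)) atTop (nhds v) ∧
        Tendsto (fun k : ℕ => f (zp * q ^ k)) atTop (nhds v)) ∧
    (∃ v : ℂ, Tendsto (fun k : ℕ => Dq q f (zm * q ^ k)) atTop (nhds v) ∧
        Tendsto (fun k : ℕ => Dq q f (zp * q ^ k)) atTop (nhds v))

/-- The set of regular spectral values `S_reg = ℂ* \ {± q^{k/2}}`. -/
def Sreg (q : ℝ) (γ : ℂ) : Prop :=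
  γ ≠ 0 ∧ ∀ k : ℤ, γ ≠ ((q ^ ((k : ℝ) / 2) : ℝ) : ℂ) ∧ γ ≠ -((q ^ ((k : ℝ) / 2) : ℝ) : ℂ)

/-- The big q-Jacobi function `φ_γ(x)`. -/
def phi (q : ℝ) (a b c d : ℂ) (γ x : ℂ) : ℂ :=
  ∑' n : ℕ,
    pochN q (q / (a * x)) n * pochN q (sP q a b c d * γ) n * pochN q (sP q a b c d / γ) n /
      (pochN q q n * pochN q (c * q / a) n * pochN q (d * q / a) n) * (b * x) ^ n

/-- The asymptotic solution `Φ_γ(z q^{-k})`, in index form. -/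
def PhiIdx (q : ℝ) (a b c d : ℂ) (γ : ℂ) (z : ℝ) (k : ℤ) : ℂ :=
  let s : ℂ := sP q a b c d
  let x : ℂ := (z : ℂ) * (q : ℂ) ^ (-k)
  (s * γ) ^ k *
    (poch q ((q : ℂ) / (b * x)) * poch q ((q : ℂ) ^ 2 * γ / (a * s * x)) /
      (poch q ((q : ℂ) / (c * x)) * poch q ((q : ℂ) / (d * x)))) *
    ∑' n : ℕ,
      pochN q ((q : ℂ) * γ / s) n * pochN q (c * q * γ / (s * a)) n *
          pochN q (d * q * γ / (s * a)) n /
        (pochN q q n * pochN q ((q : ℂ) ^ 2 * γ / (a * s * x)) n * pochN q ((q : ℂ) * γ ^ 2) n) *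
        ((q : ℂ) / (b * x)) ^ n

/-- Casorati determinant at `x = z q^{-k}` for index-form functions. -/
def casDIdx (q : ℝ) (a b c d : ℂ) (f g : ℤ → ℂ) (z : ℝ) (k : ℤ) : ℂ :=
  (f k * g (k - 1) - f (k - 1) * g k) * u q a b c d (z * q ^ (-k)) /
    ((1 - (q : ℂ)) * ((z * q ^ (-k) : ℝ) : ℂ))

/-- The c-function `c_z(γ)`. -/
def cz (q : ℝ) (a b c d : ℂ) (z : ℝ) (γ : ℂ) : ℂ :=
  let s : ℂ := sP q a b c d
  poch q (s / γ) * poch q (c * q / (a * s * γ)) * poch q (d * q / (a * s * γ)) *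
      theta q (b * s * z * γ) /
    (poch q (c * q / a) * poch q (d * q / a) * poch q (1 / γ ^ 2) * theta q (b * z))

/-- The expansion coefficient `d_z(γ)`. -/
def dz (q : ℝ) (a b c d : ℂ) (z : ℝ) (γ : ℂ) : ℂ :=
  let s : ℂ := sP q a b c d
  (poch q (c * q / a) * poch q (d * q / a) * theta q (b * z) /
      (theta q (a / b) * theta q (c * z) * theta q (d * z))) *
    (poch q (c * q * γ / (s * b)) * poch q (d * q * γ / (s * b)) *
        theta q (a * s * z / (q * γ)) /
      (poch q (q * γ ^ 2) * poch q (s / γ)))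

/-- The Casorati determinant `v(γ) = D(Φ_γ^+, Φ_γ^-)`. -/
def vFun (q zm zp : ℝ) (a b c d : ℂ) (γ : ℂ) : ℂ :=
  let s : ℂ := sP q a b c d;
  -((zp : ℂ) * (1 - (q : ℂ)) * theta q ((zm : ℂ) / zp) /
      (theta q (c * zm) * theta q (d * zm) * theta q (c * zp) * theta q (d * zp))) *
    (poch q (c * q * γ / (a * s)) * poch q (d * q * γ / (a * s)) * poch q (c * q * γ / (b * s)) *
        poch q (d * q * γ / (b * s)) * poch q (s * γ) * poch q (q * γ / s) *
        theta q (a * b * s * zm * zp / (q * γ)) /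
      (γ * (poch q (q * γ ^ 2)) ^ 2))

/-- The function `v₁(γ)` in the continuous part of the spectral measure. -/
def v1Fun (q zm zp : ℝ) (a b c d : ℂ) (γ : ℂ) : ℂ :=
  let s : ℂ := sP q a b c d
  ((poch q (c * q / a)) ^ 2 * (poch q (d * q / a)) ^ 2 * theta q (b * zp) * theta q (b * zm) /
      ((1 - (q : ℂ)) * a * b * (zm : ℂ) ^ 2 * (zp : ℂ) ^ 2 *
        (theta q ((zm : ℂ) / zp) * theta q ((zp : ℂ) / zm) * theta q (a / b) * theta q (b / a)))) *
    (poch q (γ ^ 2) * poch q (γ⁻¹ ^ 2) /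
      (poch q (s * γ) * poch q (s / γ) * poch q (c * q * γ / (a * s)) *
        poch q (c * q / (a * s * γ)) * poch q (d * q * γ / (a * s)) *
        poch q (d * q / (a * s * γ)) *
        (theta q (s * γ) * theta q (s / γ) * theta q (a * b * s * zm * zp * γ) *
          theta q (a * b * s * zm * zp / γ)))) *
    ((zm : ℂ) * (theta q (a * zp) * theta q (c * zp) * theta q (d * zp) * theta q (b * zm) *
          theta q (a * s * zm * γ) * theta q (a * s * zm / γ)) -
      (zp : ℂ) * (theta q (a * zm) * theta q (c * zm) * theta q (d * zm) * theta q (b * zp) *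
          theta q (a * s * zp * γ) * theta q (a * s * zp / γ)))

/-- The function `v₂(γ)` in the continuous part of the spectral measure. -/
def v2Fun (q zm zp : ℝ) (a b c d : ℂ) (γ : ℂ) : ℂ :=
  let s : ℂ := sP q a b c d
  (poch q (c * q / a) * poch q (d * q / a) * poch q (c * q / b) * poch q (d * q / b) *
      (theta q (a * zp) * theta q (a * zm) * theta q (b * zp) * theta q (b * zm) *
        theta q (c * d * zm * zp)) /
      (a * b * (zm : ℂ) ^ 2 * (zp : ℂ) * (1 - (q : ℂ)) *
        (theta q ((zp : ℂ) / zm) * theta q (a / b) * theta q (b / a)))) *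
    (poch q (γ ^ 2) * poch q (γ⁻¹ ^ 2) /
      (poch q (s * γ) * poch q (s / γ) *
        (theta q (s * γ) * theta q (s / γ) * theta q (a * b * s * zm * zp * γ) *
          theta q (a * b * s * zm * zp / γ))))

/-- The function `u₁(γ)`. -/
def u1Fun (q zm zp : ℝ) (a b c d : ℂ) (γ : ℂ) : ℂ :=
  Kz q a b c d zp * cz q a b c d zp γ * cz q a b c d zp γ⁻¹ -
    Kz q a b c d zm * cz q a b c d zm γ * cz q a b c d zm γ⁻¹

/-- The function `u₂(γ)`. -/
def u2Fun (q zm zp : ℝ) (a b c d : ℂ) (γ : ℂ) : ℂ :=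
  Kz q a b c d zp * cz q a b c d zp γ * cz q b a c d zp γ⁻¹ -
    Kz q a b c d zm * cz q a b c d zm γ * cz q b a c d zm γ⁻¹

/-- The big q-Jacobi polynomial `P_k(y; α, β, δ; q)`. -/
def bigqJacobiP (q : ℝ) (α β δ : ℂ) (k : ℕ) (y : ℂ) : ℂ :=
  ∑ j ∈ Finset.range (k + 1),
    pochN q (((q : ℂ) ^ k)⁻¹) j * pochN q (α * β * (q : ℂ) ^ (k + 1)) j * pochN q y j /
      (pochN q q j * pochN q (α * q) j * pochN q (δ * q) j) * (q : ℂ) ^ j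

/-- `f` equals `1 + O(t)` as `t → 0`. -/
def NearOne (f : ℂ → ℂ) : Prop :=
  (fun t => f t - 1) =O[nhds 0] fun t => t

lemma NearOne.tendsto {f : ℂ → ℂ} (hf : NearOne f) : Tendsto f (nhds 0) (nhds 1) := by
  have h := hf.trans_tendsto (tendsto_id (α := ℂ) (x := nhds 0))
  simpa using h.add_const 1

lemma NearOne.mul {f g : ℂ → ℂ} (hf : NearOne f) (hg : NearOne g) :
    NearOne fun t => f t * g t := by
  have h := Asymptotics.IsBigO.mul hf (hg.tendsto.isBigO_one ℂ)
  simp only [mul_one] at h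
  exact (h.add hg).congr_left fun t => by ring

lemma NearOne.inv {f : ℂ → ℂ} (hf : NearOne f) : NearOne fun t => (f t)⁻¹ := by
  have hne : ∀ᶠ t in nhds (0 : ℂ), f t ≠ 0 := hf.tendsto.eventually_ne one_ne_zero
  have h := hf.neg_left.mul ((hf.tendsto.inv₀ one_ne_zero).isBigO_one ℂ)
  simp only [mul_one] at h
  refine h.congr' ?_ EventuallyEq.rfl
  filter_upwards [hne] with t ht
  field_simp
  ring

lemma NearOne.div {f g : ℂ → ℂ} (hf : NearOne f) (hg : NearOne g) :
    NearOne fun t => f t / g t := by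
  simpa only [div_eq_mul_inv] using hf.mul hg.inv

lemma NearOne.comp_mul {f : ℂ → ℂ} (hf : NearOne f) (α : ℂ) : NearOne fun t => f (α * t) := by
  have ht : Tendsto (fun t : ℂ => α * t) (nhds 0) (nhds 0) := by
    simpa using (continuous_const_mul α).tendsto (0 : ℂ)
  exact (hf.comp_tendsto ht).trans (Asymptotics.isBigO_const_mul_self α _ _)

lemma nearOne_one_sub : NearOne fun t => 1 - t := by
  simpa [NearOne] using (Asymptotics.isBigO_refl (fun t : ℂ => t) (nhds 0)).neg_left

section QPochhammer

variable {q : ℝ}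

lemma summable_norm_neg_mul_pow (hq0 : 0 < q) (hq1 : q < 1) (x : ℂ) :
    Summable fun j : ℕ => ‖-(x * (q : ℂ) ^ j)‖ := by
  simp only [norm_neg, norm_mul, norm_pow, Complex.norm_real, Real.norm_eq_abs, abs_of_pos hq0]
  exact (summable_geometric_of_lt_one hq0.le hq1).mul_left _

lemma multipliable_poch (hq0 : 0 < q) (hq1 : q < 1) (x : ℂ) :
    Multipliable fun j : ℕ => 1 - x * (q : ℂ) ^ j := by
  simpa only [sub_eq_add_neg] using
    multipliable_one_add_of_summable (summable_norm_neg_mul_pow hq0 hq1 x)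

lemma poch_eq_one_sub_mul (hq0 : 0 < q) (hq1 : q < 1) (x : ℂ) :
    poch q x = (1 - x) * poch q (x * q) := by
  unfold poch
  rw [tprod_eq_zero_mul']
  · simp [pow_succ', mul_assoc]
  · simpa [pow_succ', mul_assoc] using multipliable_poch hq0 hq1 (x * q)

lemma nearOne_poch (hq0 : 0 < q) (hq1 : q < 1) : NearOne (poch q) := by
  have h1q : 0 < 1 - q := sub_pos.2 hq1
  refine Asymptotics.IsBigO.of_bound (2 / (1 - q)) ?_
  filter_upwards [Metric.ball_mem_nhds (0 : ℂ) h1q] with t ht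
  have ht' : ‖t‖ < 1 - q := by simpa using ht
  have hs : ∑' j : ℕ, ‖-(t * (q : ℂ) ^ j)‖ = ‖t‖ / (1 - q) := by
    simp only [norm_neg, norm_mul, norm_pow, Complex.norm_real, Real.norm_eq_abs, abs_of_pos hq0]
    rw [tsum_mul_left, tsum_geometric_of_lt_one hq0.le hq1, div_eq_mul_inv]
  have h : ‖poch q t - 1‖ ≤ Real.exp (‖t‖ / (1 - q)) - 1 := by
    refine le_of_tendsto ((multipliable_poch hq0 hq1 t).hasProd.sub_const 1).norm
      (Eventually.of_forall fun s => ?_)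
    simp only [sub_eq_add_neg (1 : ℂ)]
    refine (Finset.norm_prod_one_add_sub_one_le s _).trans ?_
    rw [← hs]
    gcongr
    exact (summable_norm_neg_mul_pow hq0 hq1 t).sum_le_tsum _ fun _ _ => norm_nonneg _
  have hy0 : 0 ≤ ‖t‖ / (1 - q) := by positivity
  have hy1 : ‖t‖ / (1 - q) ≤ 1 := (div_le_one h1q).2 ht'.le
  have he := Real.abs_exp_sub_one_le (x := ‖t‖ / (1 - q)) (by rwa [abs_of_nonneg hy0])
  rw [abs_of_nonneg hy0] at he
  calc ‖poch q t - 1‖ ≤ Real.exp (‖t‖ / (1 - q)) - 1 := h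
    _ ≤ 2 * (‖t‖ / (1 - q)) := (le_abs_self _).trans he
    _ = 2 / (1 - q) * ‖t‖ := by ring

lemma tendsto_one_sub_mul_pow (hq0 : 0 < q) (hq1 : q < 1) (x : ℂ) :
    Tendsto (fun j : ℕ => 1 - x * (q : ℂ) ^ j) atTop (nhds 1) := by
  have h : Tendsto (fun j : ℕ => (q : ℂ) ^ j) atTop (nhds 0) :=
    tendsto_pow_atTop_nhds_zero_of_norm_lt_one (by simpa [abs_of_pos hq0] using hq1)
  simpa using (h.const_mul x).const_sub 1

lemma exists_norm_pochN_le (hq0 : 0 < q) (hq1 : q < 1) (x : ℂ) :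
    ∃ C : ℝ, 0 < C ∧ ∀ n, ‖pochN q x n‖ ≤ C ^ n := by
  obtain ⟨C, hC⟩ := (tendsto_one_sub_mul_pow hq0 hq1 x).norm.bddAbove_range
  refine ⟨max C 1, by positivity, fun n => ?_⟩
  rw [pochN, norm_prod]
  refine (Finset.prod_le_prod (fun _ _ => norm_nonneg _) (g := fun _ => max C 1) fun j _ => ?_).trans
    (by simp)
  exact (hC ⟨j, rfl⟩).trans (le_max_left _ _)

lemma exists_norm_inv_pochN_le (hq0 : 0 < q) (hq1 : q < 1) (x : ℂ) :
    ∃ C : ℝ, 0 < C ∧ ∀ n, ‖(pochN q x n)⁻¹‖ ≤ C ^ n := by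
  obtain ⟨C, hC⟩ :=
    ((tendsto_one_sub_mul_pow hq0 hq1 x).inv₀ one_ne_zero).norm.bddAbove_range
  refine ⟨max C 1, by positivity, fun n => ?_⟩
  rw [pochN, ← Finset.prod_inv_distrib, norm_prod]
  refine (Finset.prod_le_prod (fun _ _ => norm_nonneg _) (g := fun _ => max C 1) fun j _ => ?_).trans
    (by simp)
  exact (hC ⟨j, rfl⟩).trans (le_max_left _ _)

lemma norm_inv_pochN_le_two_pow (hq0 : 0 < q) (hq1 : q < 1) {x : ℂ} (hx : ‖x‖ ≤ 1 / 2) (n : ℕ) :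
    ‖(pochN q x n)⁻¹‖ ≤ 2 ^ n := by
  rw [pochN, ← Finset.prod_inv_distrib, norm_prod]
  refine (Finset.prod_le_prod (fun _ _ => norm_nonneg _) (g := fun _ => 2) fun j _ => ?_).trans
    (by simp)
  have hj : ‖x * (q : ℂ) ^ j‖ ≤ 1 / 2 := by
    rw [norm_mul, norm_pow, Complex.norm_real, Real.norm_eq_abs, abs_of_pos hq0]
    calc ‖x‖ * q ^ j ≤ ‖x‖ * 1 := by gcongr; exact pow_le_one₀ hq0.le hq1.le
      _ ≤ 1 / 2 := by simpa using hx
  have h := norm_sub_norm_le (1 : ℂ) (x * (q : ℂ) ^ j)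
  rw [norm_one] at h
  rw [norm_inv]
  exact inv_le_of_inv_le₀ two_pos (by linarith)

/-- A power series type sum whose `n`-th coefficient grows at most geometrically, with constant
term `1`, is `1 + O(t)`. -/
lemma nearOne_tsum {f : ℕ → ℂ → ℂ} {R : ℝ} (hR : 0 < R) (h0 : ∀ t, f 0 t = 1)
    (hf : ∀ᶠ t in nhds (0 : ℂ), ∀ n, ‖f n t‖ ≤ (R * ‖t‖) ^ n) :
    NearOne fun t => ∑' n, f n t := by
  refine Asymptotics.IsBigO.of_bound (2 * R) ?_
  filter_upwards [hf, Metric.ball_mem_nhds (0 : ℂ) (show 0 < 1 / (2 * R) by positivity)]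
    with t ht htR
  have hy : R * ‖t‖ < 1 / 2 := by
    have : ‖t‖ < 1 / (2 * R) := by simpa using htR
    rw [lt_div_iff₀ (by positivity)] at this
    linarith
  have hy0 : 0 ≤ R * ‖t‖ := by positivity
  have hg := hasSum_geometric_of_lt_one hy0 (by linarith : R * ‖t‖ < 1)
  have hs : Summable fun n => f n t := Summable.of_norm_bounded hg.summable ht
  rw [hs.tsum_eq_zero_add, h0, add_sub_cancel_left]
  have hb : ‖∑' n, f (n + 1) t‖ ≤ R * ‖t‖ * (1 - R * ‖t‖)⁻¹ :=
    tsum_of_norm_bounded (hg.mul_left (R * ‖t‖)) fun n => by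
      simpa [pow_succ'] using ht (n + 1)
  refine hb.trans ?_
  have hinv : (1 - R * ‖t‖)⁻¹ ≤ 2 := inv_le_of_inv_le₀ two_pos (by linarith)
  nlinarith

lemma nearOne_phi32 (hq0 : 0 < q) (hq1 : q < 1) (α β δ ε ζ η κ : ℂ) :
    NearOne fun t => ∑' n : ℕ, pochN q α n * pochN q β n * pochN q δ n /
      (pochN q ζ n * pochN q (ε * t) n * pochN q η n) * (κ * t) ^ n := by
  obtain ⟨C₁, hC₁, h₁⟩ := exists_norm_pochN_le hq0 hq1 α
  obtain ⟨C₂, hC₂, h₂⟩ := exists_norm_pochN_le hq0 hq1 β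
  obtain ⟨C₃, hC₃, h₃⟩ := exists_norm_pochN_le hq0 hq1 δ
  obtain ⟨C₄, hC₄, h₄⟩ := exists_norm_inv_pochN_le hq0 hq1 ζ
  obtain ⟨C₅, hC₅, h₅⟩ := exists_norm_inv_pochN_le hq0 hq1 η
  refine nearOne_tsum (R := C₁ * C₂ * C₃ * (C₄ * 2 * C₅) * (‖κ‖ + 1)) (by positivity)
    (fun t => by simp [pochN]) ?_
  have ht : Tendsto (fun t : ℂ => ‖ε * t‖) (nhds 0) (nhds 0) := by
    simpa using ((continuous_const_mul ε).norm).tendsto (0 : ℂ)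
  filter_upwards [ht.eventually_le_const (show (0 : ℝ) < 1 / 2 by norm_num)] with t ht n
  have h₆ := norm_inv_pochN_le_two_pow hq0 hq1 ht n
  rw [div_eq_mul_inv, mul_inv, mul_inv]
  simp only [norm_mul, norm_pow, mul_pow]
  rw [mul_assoc _ ((‖κ‖ + 1) ^ n)]
  gcongr
  · exact h₁ n
  · exact h₂ n
  · exact h₃ n
  · exact h₄ n
  · exact h₅ n
  · linarith

/-- Quasi-periodicity of the theta function. -/
lemma poch_mul_poch_eq (hq0 : 0 < q) (hq1 : q < 1) {y : ℂ} (hy0 : y ≠ 0)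
    (hy : ∀ k : ℤ, y ≠ (q : ℂ) ^ k) (k : ℕ) :
    poch q (y / (q : ℂ) ^ k) * poch q (q / y * (q : ℂ) ^ k) =
      y ^ k * (∏ j ∈ Finset.range k, -((q : ℂ) ^ (j + 1))⁻¹) * theta q y := by
  have hq : (q : ℂ) ≠ 0 := by exact_mod_cast hq0.ne'
  induction k with
  | zero => simp [theta]
  | succ k ih =>
    have hne : y - (q : ℂ) ^ (k + 1) ≠ 0 := sub_ne_zero.2 (by exact_mod_cast hy (k + 1 : ℕ))
    have e1 := poch_eq_one_sub_mul hq0 hq1 (y / (q : ℂ) ^ (k + 1))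
    have e2 := poch_eq_one_sub_mul hq0 hq1 (q / y * (q : ℂ) ^ k)
    have e3 : y / (q : ℂ) ^ (k + 1) * q = y / (q : ℂ) ^ k := by field_simp; ring
    have e4 : q / y * (q : ℂ) ^ k * q = q / y * (q : ℂ) ^ (k + 1) := by ring
    have e5 : 1 - q / y * (q : ℂ) ^ k = (y - (q : ℂ) ^ (k + 1)) / y := by field_simp; ring
    have e6 : 1 - y / (q : ℂ) ^ (k + 1) =
        -((q : ℂ) ^ (k + 1))⁻¹ * (y - (q : ℂ) ^ (k + 1)) := by field_simp; ring
    rw [e3, e6] at e1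
    rw [e4, e5] at e2
    rw [e1, Finset.prod_range_succ, pow_succ y]
    have e7 : poch q (q / y * (q : ℂ) ^ (k + 1)) =
        y / (y - (q : ℂ) ^ (k + 1)) * poch q (q / y * (q : ℂ) ^ k) := by
      rw [e2]; field_simp
    rw [e7]
    calc _ = -((q : ℂ) ^ (k + 1))⁻¹ * y *
          (poch q (y / (q : ℂ) ^ k) * poch q (q / y * (q : ℂ) ^ k)) := by field_simp
      _ = _ := by rw [ih]; ring

end QPochhammer

/-- The factor `Φ_γ(x) / (sγ)^k` of the asymptotic solution, as a function of `t = z / x`. -/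
def phiFactor (q : ℝ) (a b c d γ : ℂ) (z : ℝ) (t : ℂ) : ℂ :=
  poch q ((q : ℂ) / (b * z) * t) * poch q ((q : ℂ) ^ 2 * γ / (a * sP q a b c d * z) * t) /
      (poch q ((q : ℂ) / (c * z) * t) * poch q ((q : ℂ) / (d * z) * t)) *
    ∑' n : ℕ,
      pochN q ((q : ℂ) * γ / sP q a b c d) n * pochN q (c * q * γ / (sP q a b c d * a)) n *
          pochN q (d * q * γ / (sP q a b c d * a)) n /
        (pochN q q n * pochN q ((q : ℂ) ^ 2 * γ / (a * sP q a b c d * z) * t) n *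
          pochN q ((q : ℂ) * γ ^ 2) n) *
        ((q : ℂ) / (b * z) * t) ^ n

lemma PhiIdx_eq (q : ℝ) (a b c d γ : ℂ) (z : ℝ) (k : ℤ) :
    PhiIdx q a b c d γ z k =
      (sP q a b c d * γ) ^ k * phiFactor q a b c d γ z ((q : ℂ) ^ k) := by
  have h (m n : ℂ) : m / (n * ((z : ℂ) * (q : ℂ) ^ (-k))) = m / (n * z) * (q : ℂ) ^ k := by
    simp only [zpow_neg, div_eq_mul_inv, mul_inv, inv_inv]
    ring
  simp only [PhiIdx, phiFactor, h]
  ring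

lemma nearOne_phiFactor {q : ℝ} (hq0 : 0 < q) (hq1 : q < 1) (a b c d γ : ℂ) (z : ℝ) :
    NearOne (phiFactor q a b c d γ z) := by
  have hp (α : ℂ) := (nearOne_poch hq0 hq1).comp_mul α
  exact (((hp _).mul (hp _)).div ((hp _).mul (hp _))).mul (nearOne_phi32 hq0 hq1 _ _ _ _ _ _ _)

/-- The correction factor of `u(x) / ((1 - q) x)` relative to its leading behaviour, as a function
of `t = z / x`. -/
def weightFactor (q : ℝ) (a b c d : ℂ) (z : ℝ) (t : ℂ) : ℂ :=
  (1 - 1 / (c * z) * t) * (1 - 1 / (d * z) * t) *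
    (poch q ((q : ℂ) / (c * z) * t) * poch q ((q : ℂ) / (d * z) * t) /
      (poch q ((q : ℂ) / (a * z) * t) * poch q ((q : ℂ) / (b * z) * t)))

lemma nearOne_weightFactor {q : ℝ} (hq0 : 0 < q) (hq1 : q < 1) (a b c d : ℂ) (z : ℝ) :
    NearOne (weightFactor q a b c d z) := by
  have hp (α : ℂ) := (nearOne_poch hq0 hq1).comp_mul α
  have hs (α : ℂ) := nearOne_one_sub.comp_mul α
  exact ((hs _).mul (hs _)).mul (((hp _).mul (hp _)).div ((hp _).mul (hp _)))

lemma sP_sq (q : ℝ) (a b c d : ℂ) : sP q a b c d ^ 2 = c * d * (q : ℂ) / (a * b) := by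
  rw [sP, ← Complex.cpow_nat_mul]
  norm_num

lemma w_eq {q : ℝ} (hq0 : 0 < q) (hq1 : q < 1) {a b c d : ℂ} {z : ℝ} (hz : z ≠ 0)
    (ha : a ≠ 0) (hb : b ≠ 0) (hc : c ≠ 0) (hd : d ≠ 0)
    (hpow : ∀ x ∈ ({a, b, c, d} : Set ℂ), ∀ k : ℤ, x * z ≠ (q : ℂ) ^ k) (k : ℕ)
    (hne : ∀ x ∈ ({a, b, c, d} : Set ℂ), poch q (q / (x * z) * (q : ℂ) ^ k) ≠ 0) :
    w q a b c d (z * q ^ (-(k : ℤ))) =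
      a ^ k * b ^ k / (c ^ k * d ^ k) *
        (theta q (a * z) * theta q (b * z) / (theta q (c * z) * theta q (d * z))) *
        (poch q (q / (c * z) * (q : ℂ) ^ k) * poch q (q / (d * z) * (q : ℂ) ^ k) /
          (poch q (q / (a * z) * (q : ℂ) ^ k) * poch q (q / (b * z) * (q : ℂ) ^ k))) := by
  have hq : (q : ℂ) ≠ 0 := by exact_mod_cast hq0.ne'
  have hzC : (z : ℂ) ≠ 0 := by exact_mod_cast hz
  set e : ℂ := ∏ j ∈ Finset.range k, -((q : ℂ) ^ (j + 1))⁻¹ with he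
  have he0 : e ≠ 0 := Finset.prod_ne_zero_iff.2 fun j _ => by simp [hq]
  have key (x : ℂ) (hx0 : x ≠ 0) (hx : x ∈ ({a, b, c, d} : Set ℂ)) :
      poch q (x * ((z * q ^ (-(k : ℤ)) : ℝ) : ℂ)) =
        (x * z) ^ k * e * theta q (x * z) / poch q (q / (x * z) * (q : ℂ) ^ k) := by
    rw [eq_div_iff (hne x hx), he, ← poch_mul_poch_eq hq0 hq1 (mul_ne_zero hx0 hzC) (hpow x hx)]
    push_cast
    rw [zpow_neg, zpow_natCast, ← mul_assoc, ← div_eq_mul_inv]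
  have hc' := hne c (by simp)
  have hd' := hne d (by simp)
  rw [w, key a ha (by simp), key b hb (by simp), key c hc (by simp), key d hd (by simp)]
  simp only [div_eq_mul_inv, mul_inv, inv_inv, mul_pow]
  field_simp

lemma casDIdx_PhiIdx_eq {q : ℝ} (hq0 : 0 < q) (hq1 : q < 1) {a b c d : ℂ} {z : ℝ} (hz : z ≠ 0)
    (ha : a ≠ 0) (hb : b ≠ 0) (hc : c ≠ 0) (hd : d ≠ 0)
    (hpow : ∀ x ∈ ({a, b, c, d} : Set ℂ), ∀ k : ℤ, x * z ≠ (q : ℂ) ^ k) {γ₁ γ₂ : ℂ}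
    (h1 : γ₁ ≠ 0) (h2 : γ₂ ≠ 0) (k : ℕ)
    (hne : ∀ x ∈ ({a, b, c, d} : Set ℂ), poch q (q / (x * z) * (q : ℂ) ^ k) ≠ 0) :
    casDIdx q a b c d (PhiIdx q a b c d γ₁ z) (PhiIdx q a b c d γ₂ z) z k =
      (γ₁ * γ₂) ^ ((k : ℤ) - 1) * Kz q a b c d z *
        (weightFactor q a b c d z ((q : ℂ) ^ k) *
          (γ₁ * (phiFactor q a b c d γ₁ z ((q : ℂ) ^ k) *
              phiFactor q a b c d γ₂ z ((q : ℂ)⁻¹ * (q : ℂ) ^ k)) -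
            γ₂ * (phiFactor q a b c d γ₁ z ((q : ℂ)⁻¹ * (q : ℂ) ^ k) *
              phiFactor q a b c d γ₂ z ((q : ℂ) ^ k)))) := by
  have hq : (q : ℂ) ≠ 0 := by exact_mod_cast hq0.ne'
  have h1q : (1 - q : ℂ) ≠ 0 := sub_ne_zero.2 (by exact_mod_cast hq1.ne')
  have hzC : (z : ℂ) ≠ 0 := by exact_mod_cast hz
  have hssq := sP_sq q a b c d
  have hs0 : sP q a b c d ≠ 0 := by
    intro h
    rw [h, zero_pow two_ne_zero] at hssq
    exact div_ne_zero (mul_ne_zero (mul_ne_zero hc hd) hq) (mul_ne_zero ha hb) hssq.symm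
  have hsk : (sP q a b c d ^ k) ^ 2 * (a ^ k * b ^ k) = c ^ k * d ^ k * (q : ℂ) ^ k := by
    rw [← pow_mul, mul_comm k 2, pow_mul, hssq, ← mul_pow, ← mul_pow, ← mul_pow, ← mul_pow]
    congr 1
    field_simp
  have hq1k : (q : ℂ) ^ ((k : ℤ) - 1) = (q : ℂ)⁻¹ * (q : ℂ) ^ k := by
    rw [zpow_sub_one₀ hq, zpow_natCast, mul_comm]
  simp only [casDIdx, PhiIdx_eq, hq1k, u, w_eq hq0 hq1 hz ha hb hc hd hpow k hne, Bcoef,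
    weightFactor, Kz, zpow_natCast]
  rw [zpow_sub_one₀ (mul_ne_zero hs0 h1), zpow_sub_one₀ (mul_ne_zero hs0 h2),
    zpow_sub_one₀ (mul_ne_zero h1 h2)]
  push_cast
  simp only [zpow_neg, zpow_natCast, mul_pow]
  have hqk : (q : ℂ) ^ k ≠ 0 := pow_ne_zero _ hq
  have hck : c ^ k ≠ 0 := pow_ne_zero _ hc
  have hdk : d ^ k ≠ 0 := pow_ne_zero _ hd
  generalize phiFactor q a b c d γ₁ z ((q : ℂ) ^ k) = F₁
  generalize phiFactor q a b c d γ₂ z ((q : ℂ) ^ k) = F₂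
  generalize phiFactor q a b c d γ₁ z ((q : ℂ)⁻¹ * (q : ℂ) ^ k) = G₁
  generalize phiFactor q a b c d γ₂ z ((q : ℂ)⁻¹ * (q : ℂ) ^ k) = G₂
  generalize poch q (q / (c * z) * (q : ℂ) ^ k) * poch q (q / (d * z) * (q : ℂ) ^ k) /
    (poch q (q / (a * z) * (q : ℂ) ^ k) * poch q (q / (b * z) * (q : ℂ) ^ k)) = W
  rw [mul_div_assoc (z * (1 - q) : ℂ)]
  generalize theta q (a * z) * theta q (b * z) / (theta q (c * z) * theta q (d * z)) = T
  generalize sP q a b c d ^ k = sk at *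
  generalize sP q a b c d = s at *
  generalize a ^ k = ak at *
  generalize b ^ k = bk at *
  generalize c ^ k = ck at *
  generalize d ^ k = dk at *
  have hC : 1 / (c * ((z : ℂ) * ((q : ℂ) ^ k)⁻¹)) = 1 / (c * z) * (q : ℂ) ^ k := by field_simp
  have hD : 1 / (d * ((z : ℂ) * ((q : ℂ) ^ k)⁻¹)) = 1 / (d * z) * (q : ℂ) ^ k := by field_simp
  rw [hC, hD]
  generalize (1 - 1 / (c * z) * (q : ℂ) ^ k) = C
  generalize (1 - 1 / (d * z) * (q : ℂ) ^ k) = D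
  generalize (q : ℂ) ^ k = t at *
  have hone : sk ^ 2 * (ak * bk / (ck * dk)) * t⁻¹ = 1 := by
    rw [mul_div_assoc', hsk]; field_simp
  generalize γ₁ ^ k = g₁
  generalize γ₂ ^ k = g₂
  calc _ = (sk ^ 2 * (ak * bk / (ck * dk)) * t⁻¹) * (g₁ * g₂ * (γ₁ * γ₂)⁻¹ *
        (z * (1 - q) * T) * (C * D * W * (γ₁ * (F₁ * G₂) - γ₂ * (G₁ * F₂)))) := by
        field_simp
    _ = _ := by rw [hone, one_mul]

/-- asymptotics of the Casorati determinant of two asymptotic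
solutions `Φ_{γ₁}, Φ_{γ₂}`. -/
theorem statement19 (q zm zp : ℝ) (a b c d : ℂ)
    (hq0 : 0 < q) (hq1 : q < 1) (hzm : zm < 0) (hzp : 0 < zp)
    (hPg : memPgen q zm zp a b c d) (γ₁ γ₂ : ℂ)
    (h1 : Sreg q γ₁) (h2 : Sreg q γ₂) (z : ℝ) (hz : z = zm ∨ z = zp) :
    ∃ M : ℝ, 0 < M ∧ ∃ N : ℕ, 1 / ‖b‖ < |z * q ^ (-(N : ℤ))| ∧
      ∀ k : ℕ, N ≤ k →
        ‖casDIdx q a b c d (PhiIdx q a b c d γ₁ z) (PhiIdx q a b c d γ₂ z) z k -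
            (γ₁ - γ₂) * Kz q a b c d z * (γ₁ * γ₂) ^ ((k : ℤ) - 1)‖ ≤
          M * q ^ k * ‖γ₁ * γ₂‖ ^ k := by
  have hz0 : z ≠ 0 := by rcases hz with rfl | rfl <;> [exact hzm.ne; exact hzp.ne']
  have hzC : (z : ℂ) ≠ 0 := by exact_mod_cast hz0
  have hqC : (q : ℂ) ≠ 0 := by exact_mod_cast hq0.ne'
  obtain ⟨⟨ha, hb, hc, hd, -, hP, -⟩, -⟩ := hPg
  have hpow : ∀ x ∈ ({a, b, c, d} : Set ℂ), ∀ k : ℤ, x * z ≠ (q : ℂ) ^ k := by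
    intro x hx k h
    have hx' : x = (z : ℂ)⁻¹ * (q : ℂ) ^ k := by rw [← h]; field_simp
    rcases hz with rfl | rfl
    · exact (hP x hx k).2 hx'
    · exact (hP x hx k).1 hx'
  have hqlim : Tendsto (fun k : ℕ => (q : ℂ) ^ k) atTop (nhds 0) :=
    tendsto_pow_atTop_nhds_zero_of_norm_lt_one (by simpa [abs_of_pos hq0] using hq1)
  have hne (x : ℂ) : ∀ᶠ k : ℕ in atTop, poch q (q / (x * z) * (q : ℂ) ^ k) ≠ 0 :=
    (((nearOne_poch hq0 hq1).comp_mul (q / (x * z))).tendsto.comp hqlim).eventually_ne one_ne_zero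
  have hW := nearOne_weightFactor hq0 hq1 a b c d z
  have hF (γ : ℂ) := nearOne_phiFactor hq0 hq1 a b c d γ z
  have hG (γ : ℂ) := (hF γ).comp_mul (q : ℂ)⁻¹
  have hO := (((hW.mul ((hF γ₁).mul (hG γ₂))).const_mul_left γ₁).sub
    ((hW.mul ((hG γ₁).mul (hF γ₂))).const_mul_left γ₂)).comp_tendsto hqlim
  obtain ⟨C, hC⟩ := hO.bound
  have hlarge : ∀ᶠ k : ℕ in atTop, 1 / ‖b‖ < |z * q ^ (-(k : ℤ))| := by
    have h : Tendsto (fun k : ℕ => |z| * q⁻¹ ^ k) atTop atTop :=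
      (tendsto_pow_atTop_atTop_of_one_lt ((one_lt_inv₀ hq0).2 hq1)).const_mul_atTop
        (abs_pos.2 hz0)
    filter_upwards [h.eventually_gt_atTop (1 / ‖b‖)] with k hk
    rwa [zpow_neg, zpow_natCast, abs_mul, abs_inv, abs_pow, abs_of_pos hq0, ← inv_pow]
  obtain ⟨N, hN⟩ := eventually_atTop.1
    (hlarge.and (hC.and ((hne a).and ((hne b).and ((hne c).and (hne d))))))
  refine ⟨‖γ₁ * γ₂‖⁻¹ * ‖Kz q a b c d z‖ * |C| + 1, by positivity, N, (hN N le_rfl).1,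
    fun k hk => ?_⟩
  obtain ⟨-, hCk, hak, hbk, hck, hdk⟩ := hN k hk
  rw [casDIdx_PhiIdx_eq hq0 hq1 hz0 ha hb hc hd hpow h1.1 h2.1 k
    (by rintro x (rfl | rfl | rfl | rfl) <;> assumption)]
  have hγ : γ₁ * γ₂ ≠ 0 := mul_ne_zero h1.1 h2.1
  simp only [Function.comp_apply, norm_pow, Complex.norm_real, Real.norm_eq_abs,
    abs_of_pos hq0] at hCk
  set W := weightFactor q a b c d z ((q : ℂ) ^ k)
  set F₁ := phiFactor q a b c d γ₁ z ((q : ℂ) ^ k)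
  set F₂ := phiFactor q a b c d γ₂ z ((q : ℂ) ^ k)
  set G₁ := phiFactor q a b c d γ₁ z ((q : ℂ)⁻¹ * (q : ℂ) ^ k)
  set G₂ := phiFactor q a b c d γ₂ z ((q : ℂ)⁻¹ * (q : ℂ) ^ k)
  have hfac : (γ₁ * γ₂) ^ ((k : ℤ) - 1) * Kz q a b c d z *
        (W * (γ₁ * (F₁ * G₂) - γ₂ * (G₁ * F₂))) -
      (γ₁ - γ₂) * Kz q a b c d z * (γ₁ * γ₂) ^ ((k : ℤ) - 1) =
      (γ₁ * γ₂) ^ ((k : ℤ) - 1) * Kz q a b c d z *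
        (γ₁ * (W * (F₁ * G₂) - 1) - γ₂ * (W * (G₁ * F₂) - 1)) := by ring
  rw [hfac, norm_mul, norm_mul, norm_zpow, zpow_sub_one₀ (norm_ne_zero_iff.2 hγ), zpow_natCast]
  calc _ ≤ ‖γ₁ * γ₂‖ ^ k * ‖γ₁ * γ₂‖⁻¹ * ‖Kz q a b c d z‖ * (|C| * q ^ k) := by
        gcongr
        exact hCk.trans (by gcongr; exact le_abs_self C)
    _ = ‖γ₁ * γ₂‖⁻¹ * ‖Kz q a b c d z‖ * |C| * q ^ k * ‖γ₁ * γ₂‖ ^ k := by ring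
    _ ≤ _ := by
        gcongr
        exact le_add_of_nonneg_right zero_le_one
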